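/- Let (x_j) be finitely many real hypotheses with prior probabilities P(x_j) summing to 1, and suppose the likelihood satisfies P(E|x_j) = α + δ_j with |δ_j| ≤ δ and α ≥ 2δ > 0. Let μ₀ = Σ_j P(x_j) x_j and μ₁ = Σ_j P(x_j|E) x_j be the prior and posterior means, where P(x_j|E) = P(E|x_j)P(x_j)/Σ_k P(E|x_k)P(x_k). Then |μ₁ − μ₀| ≤ 2δσ/α, where σ² = Σ_j P(x_j)(x_j − μ₀)² is the prior variance. -/

import Mathlib

open Finset

theorem posterior_mean_shift {n : ℕ} (x p δvec : Fin n → ℝ) (α δ : ℝ)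
    (hp : ∀ j, 0 ≤ p j) (hsum : ∑ j, p j = 1)
    (hδ : ∀ j, |δvec j| ≤ δ) (hα : 2 * δ ≤ α) (hδpos : 0 < δ)
    (μ₀ μ₁ σ : ℝ)
    (hμ₀ : μ₀ = ∑ j, p j * x j)
    (hμ₁ : μ₁ = ∑ j, ((α + δvec j) * p j / (∑ k, (α + δvec k) * p k)) * x j)
    (hσ : σ = Real.sqrt (∑ j, p j * (x j - μ₀)^2)) :
    |μ₁ - μ₀| ≤ 2 * δ * σ / α := by
  set Z := ∑ k, (α + δvec k) * p k with hZ
  have hZ2 : α / 2 ≤ Z := by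
    have h1 : ∑ k, (α / 2) * p k ≤ Z := by
      apply Finset.sum_le_sum
      intro k _
      have := (abs_le.mp (hδ k)).1
      exact mul_le_mul_of_nonneg_right (by linarith) (hp k)
    rw [← Finset.mul_sum, hsum] at h1
    linarith
  have hα0 : 0 < α := by linarith
  have hZ0 : 0 < Z := by linarith
  have hc : ∑ j, p j * (x j - μ₀) = 0 := by
    simp only [mul_sub, Finset.sum_sub_distrib, ← Finset.sum_mul, hsum, ← hμ₀]
    ring
  have h2 : μ₁ * Z = ∑ j, (α + δvec j) * p j * x j := by
    rw [hμ₁, Finset.sum_mul]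
    apply Finset.sum_congr rfl
    intro j _
    field_simp
  have h3 : (μ₁ - μ₀) * Z = ∑ j, δvec j * (p j * (x j - μ₀)) := by
    have h4 : (μ₁ - μ₀) * Z = ∑ j, (α * (p j * (x j - μ₀)) + δvec j * (p j * (x j - μ₀))) := by
      rw [sub_mul, h2, hZ, Finset.mul_sum, ← Finset.sum_sub_distrib]
      apply Finset.sum_congr rfl
      intro j _
      ring
    rw [h4, Finset.sum_add_distrib, ← Finset.mul_sum, hc]
    ring
  have h5 : |∑ j, δvec j * (p j * (x j - μ₀))| ≤ δ * ∑ j, p j * |x j - μ₀| := by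
    rw [Finset.mul_sum]
    refine (Finset.abs_sum_le_sum_abs _ _).trans (Finset.sum_le_sum ?_)
    intro j _
    rw [abs_mul, abs_mul, abs_of_nonneg (hp j)]
    exact mul_le_mul_of_nonneg_right (hδ j) (mul_nonneg (hp j) (abs_nonneg _))
  have h6 : ∑ j, p j * |x j - μ₀| ≤ σ := by
    rw [hσ]
    apply Real.le_sqrt_of_sq_le
    obtain ⟨m, hm⟩ : ∃ m, m = ∑ j, p j * |x j - μ₀| := ⟨_, rfl⟩
    rw [← hm]
    have h7 : 0 ≤ ∑ j, p j * (|x j - μ₀| - m) ^ 2 :=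
      Finset.sum_nonneg fun j _ => mul_nonneg (hp j) (sq_nonneg _)
    have h8 : ∑ j, p j * (|x j - μ₀| - m) ^ 2
        = ∑ j, p j * (x j - μ₀) ^ 2 - (2 * m) * (∑ j, p j * |x j - μ₀|) + m ^ 2 * ∑ j, p j := by
      rw [Finset.mul_sum, Finset.mul_sum, ← Finset.sum_sub_distrib, ← Finset.sum_add_distrib]
      apply Finset.sum_congr rfl
      intro j _
      rw [← sq_abs (x j - μ₀)]
      ring
    rw [← hm, hsum] at h8
    nlinarith
  have h9 : |μ₁ - μ₀| * Z ≤ δ * σ := by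
    rw [← abs_of_pos hZ0, ← abs_mul, h3]
    exact h5.trans (mul_le_mul_of_nonneg_left h6 hδpos.le)
  rw [le_div_iff₀ hα0]
  have := mul_le_mul_of_nonneg_left hZ2 (abs_nonneg (μ₁ - μ₀))
  nlinarith
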